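/- Let s : ℝ × ℝ → ℝ be a strictly 𝓕₀-consistent scoring function for the mode. Then for any two real numbers a ≠ b, s(a, y) = s(b, y) for Lebesgue almost all y ∈ ℝ; consequently, ∫ s(a, y) f(y) dy = ∫ s(b, y) f(y) dy for every f ∈ 𝓕₀. -/

import Mathlib

open MeasureTheory Set Filter

/-- `f` belongs to `𝓕₀` with mode `x₀`: continuous, nonnegative, integrates to 1,
nondecreasing on `(-∞, x₀]`, nonincreasing on `[x₀, ∞)`, and `x₀` is the unique
local (hence global) maximum. -/
def IsUnimodalDensity (f : ℝ → ℝ) (x₀ : ℝ) : Prop :=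
  Continuous f ∧ (∀ y, 0 ≤ f y) ∧ (∫ y : ℝ, f y) = 1 ∧
    MonotoneOn f (Set.Iic x₀) ∧ AntitoneOn f (Set.Ici x₀) ∧
    ∀ x, x ≠ x₀ → f x < f x₀

/-- `f` belongs to the class `𝓕₀` of strictly unimodal distributions with
continuous Lebesgue density. -/
def MemF0 (f : ℝ → ℝ) : Prop := ∃ x₀, IsUnimodalDensity f x₀

/-- `s` is a strictly `𝓕₀`-consistent scoring function for the mode. -/
def StrictlyF0Consistent (s : ℝ × ℝ → ℝ) : Prop :=
  Measurable s ∧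
  (∀ x : ℝ, ∀ f : ℝ → ℝ, MemF0 f → Integrable (fun y => |s (x, y)| * f y)) ∧
  (∀ f : ℝ → ℝ, ∀ t : ℝ, IsUnimodalDensity f t → ∀ x : ℝ,
    (∫ y : ℝ, s (t, y) * f y) ≤ (∫ y : ℝ, s (x, y) * f y) ∧
    ((∫ y : ℝ, s (t, y) * f y) = (∫ y : ℝ, s (x, y) * f y) → x = t))

/-- `v` is a strict `𝓕₀`-identification function for the mode. -/
def StrictF0Identification (v : ℝ × ℝ → ℝ) : Prop :=
  Measurable v ∧
  (∀ x : ℝ, ∀ f : ℝ → ℝ, MemF0 f → Integrable (fun y => |v (x, y)| * f y)) ∧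
  (∀ f : ℝ → ℝ, ∀ t : ℝ, IsUnimodalDensity f t → ∀ x : ℝ,
    (∫ y : ℝ, v (x, y) * f y) = 0 ↔ x = t)

noncomputable def tri (l r t k y : ℝ) : ℝ :=
  max 0 (1 - k * max (l - y) (max (y - r) 0)) + (1 / k) * max 0 (1 - |y - t|)

lemma tri_cont (l r t k : ℝ) : Continuous (tri l r t k) := by
  unfold tri; fun_prop

lemma tri_nonneg {l r t k : ℝ} (hk : 1 ≤ k) (y : ℝ) : 0 ≤ tri l r t k y := by
  unfold tri; positivity

lemma tri_zero {l r t k : ℝ} (hlt : l ≤ t) (htr : t ≤ r) (hk : 1 ≤ k) (y : ℝ)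
    (hy : y ∉ Icc (l - 1) (r + 1)) : tri l r t k y = 0 := by
  unfold tri
  have h1 : 1 ≤ max (l - y) (max (y - r) 0) ∧ 1 ≤ |y - t| := by
    by_cases h : l - 1 ≤ y
    · have : r + 1 < y := by
        by_contra h'
        exact hy ⟨h, not_lt.1 h'⟩
      exact ⟨le_max_of_le_right (le_max_of_le_left (by linarith)),
        le_trans (by linarith) (le_abs_self _)⟩
    · exact ⟨le_max_of_le_left (by linarith), le_trans (by linarith) (neg_le_abs _)⟩
  rw [max_eq_left, max_eq_left]
  · simp
  · linarith [h1.2]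
  · nlinarith [h1.1]

lemma tri_le {l r t k : ℝ} (hk : 1 ≤ k) (y : ℝ) : tri l r t k y ≤ 2 := by
  unfold tri
  have h1 : max 0 (1 - k * max (l - y) (max (y - r) 0)) ≤ 1 := by
    apply max_le zero_le_one
    have : 0 ≤ k * max (l - y) (max (y - r) 0) := by positivity
    linarith
  have h2 : max 0 (1 - |y - t|) ≤ 1 := by
    apply max_le zero_le_one
    linarith [abs_nonneg (y - t)]
  have h3 : 1 / k ≤ 1 := by
    rw [div_le_one (by linarith)]; exact hk
  have h4 : 0 ≤ 1 / k := by positivity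
  nlinarith [le_max_left 0 (1 - |y - t|)]

lemma tri_ge {l r t k : ℝ} (hk : 1 ≤ k) (y : ℝ) (hy : y ∈ Icc l r) : 1 ≤ tri l r t k y := by
  unfold tri
  have : max (l - y) (max (y - r) 0) = 0 := by
    rw [max_eq_right (a := y - r) (by linarith [hy.2]), max_eq_right (by linarith [hy.1])]
  rw [this]
  have : 0 ≤ (1 / k) * max 0 (1 - |y - t|) := by positivity
  simp only [mul_zero, sub_zero]
  rw [max_eq_right zero_le_one]
  linarith

lemma tri_lt {l r t k : ℝ} (hlt : l ≤ t) (htr : t ≤ r) (hk : 1 ≤ k) (y : ℝ) (hy : y ≠ t) :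
    tri l r t k y < tri l r t k t := by
  unfold tri
  have : max (l - t) (max (t - r) 0) = 0 := by
    rw [max_eq_right (a := t - r) (by linarith), max_eq_right (by linarith)]
  rw [this]
  have h1 : max 0 (1 - k * max (l - y) (max (y - r) 0)) ≤ max 0 (1 - k * 0) := by
    gcongr
    positivity
  have h2 : max 0 (1 - |y - t|) < max 0 (1 - |t - t|) := by
    have := abs_pos.2 (sub_ne_zero.2 hy)
    simp [this]
  have h4 : 0 < 1 / k := by positivity
  have := mul_lt_mul_of_pos_left h2 h4
  linarith

lemma tri_mono {l r t k : ℝ} (htr : t ≤ r) (hk : 1 ≤ k) :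
    MonotoneOn (tri l r t k) (Iic t) := by
  intro x hx y hy hxy
  simp only [mem_Iic] at hx hy
  unfold tri
  rw [max_eq_right (a := x - r) (by linarith), max_eq_right (a := y - r) (by linarith),
    abs_of_nonpos (a := x - t) (by linarith), abs_of_nonpos (a := y - t) (by linarith)]
  gcongr

lemma tri_anti {l r t k : ℝ} (hlt : l ≤ t) (hk : 1 ≤ k) :
    AntitoneOn (tri l r t k) (Ici t) := by
  intro x hx y hy hxy
  simp only [mem_Ici] at hx hy
  unfold tri
  rw [max_eq_right (a := l - x) (le_max_of_le_right (by linarith)),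
    max_eq_right (a := l - y) (le_max_of_le_right (by linarith)),
    abs_of_nonneg (a := x - t) (by linarith), abs_of_nonneg (a := y - t) (by linarith)]
  gcongr

lemma tri_int_pos {l r t k : ℝ} (hlt : l ≤ t) (htr : t ≤ r) (hk : 1 ≤ k) :
    0 < ∫ y, tri l r t k y := by
  apply Continuous.integral_pos_of_hasCompactSupport_nonneg_nonzero (x := t) (tri_cont l r t k)
  · exact HasCompactSupport.intro isCompact_Icc (fun y hy => tri_zero hlt htr hk y hy)
  · exact fun y => tri_nonneg hk y
  · have := tri_ge (t := t) hk t ⟨hlt, htr⟩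
    linarith

lemma tri_uni {l r t k : ℝ} (hlt : l ≤ t) (htr : t ≤ r) (hk : 1 ≤ k) :
    IsUnimodalDensity (fun y => tri l r t k y / ∫ y, tri l r t k y) t := by
  have hc := tri_int_pos hlt htr hk
  refine ⟨(tri_cont l r t k).div_const _, fun y => div_nonneg (tri_nonneg hk y) hc.le, ?_, ?_, ?_, ?_⟩
  · rw [integral_div, div_self hc.ne']
  · intro x hx y hy hxy
    exact div_le_div_of_nonneg_right (tri_mono htr hk hx hy hxy) hc.le
  · intro x hx y hy hxy
    exact div_le_div_of_nonneg_right (tri_anti hlt hk hx hy hxy) hc.le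
  · intro x hx
    exact div_lt_div_of_pos_right (tri_lt hlt htr hk x hx) hc

lemma tri_tendsto (l r t y : ℝ) :
    Tendsto (fun n : ℕ => tri l r t ((n : ℝ) + 1) y) atTop (nhds ((Icc l r).indicator 1 y)) := by
  unfold tri
  have h2 : Tendsto (fun n : ℕ => 1 / ((n : ℝ) + 1) * max 0 (1 - |y - t|)) atTop (nhds 0) := by
    simpa using (tendsto_one_div_add_atTop_nhds_zero_nat (𝕜 := ℝ)).mul_const (max 0 (1 - |y - t|))
  rw [← add_zero ((Icc l r).indicator 1 y)]
  refine Tendsto.add ?_ h2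
  by_cases hy : y ∈ Icc l r
  · have : max (l - y) (max (y - r) 0) = 0 := by
      rw [max_eq_right (a := y - r) (by linarith [hy.2]), max_eq_right (by linarith [hy.1])]
    simp [this, hy]
  · have hd : 0 < max (l - y) (max (y - r) 0) := by
      by_cases h : l ≤ y
      · have : r < y := by
          by_contra h'
          exact hy ⟨h, not_lt.1 h'⟩
        exact lt_max_of_lt_right (lt_max_of_lt_left (by linarith))
      · exact lt_max_of_lt_left (by linarith)
    rw [indicator_of_notMem hy]
    generalize max (l - y) (max (y - r) 0) = d at hd
    apply tendsto_const_nhds.congr'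
    obtain ⟨N, hN⟩ := exists_nat_gt (1 / d)
    filter_upwards [eventually_ge_atTop N] with n hn
    have hn' : (N : ℝ) ≤ n := by exact_mod_cast hn
    rw [div_lt_iff₀ hd] at hN
    rw [max_eq_left]
    nlinarith

lemma s_meas {s : ℝ × ℝ → ℝ} (hs : StrictlyF0Consistent s) (x : ℝ) :
    Measurable (fun y => s (x, y)) := hs.1.comp (by fun_prop)

lemma s_intOn {s : ℝ × ℝ → ℝ} (hs : StrictlyF0Consistent s) (x l r : ℝ) (hlr : l ≤ r) :
    IntegrableOn (fun y => s (x, y)) (Icc l r) := by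
  have hu := tri_uni (k := 1) le_rfl hlr le_rfl
  have hc := tri_int_pos (k := 1) le_rfl hlr le_rfl
  have := (hs.2.1 x _ ⟨_, hu⟩).mul_const (∫ y, tri l r l 1 y)
  refine Integrable.mono' (this.integrableOn (s := Icc l r)) (s_meas hs x).aestronglyMeasurable ?_
  filter_upwards [ae_restrict_mem measurableSet_Icc] with y hy
  have h1 := tri_ge (t := l) (k := 1) le_rfl y hy
  rw [mul_assoc, div_mul_cancel₀ _ hc.ne', Real.norm_eq_abs]
  nlinarith [abs_nonneg (s (x, y))]

lemma s_loc {s : ℝ × ℝ → ℝ} (hs : StrictlyF0Consistent s) (x : ℝ) :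
    LocallyIntegrable (fun y => s (x, y)) := by
  intro z
  exact ⟨Icc (z - 1) (z + 1), Icc_mem_nhds (by linarith) (by linarith),
    s_intOn hs x _ _ (by linarith)⟩

lemma s_lim {s : ℝ × ℝ → ℝ} (hs : StrictlyF0Consistent s) (x l r t : ℝ) (hlt : l ≤ t)
    (htr : t ≤ r) :
    Tendsto (fun n : ℕ => ∫ y, s (x, y) * tri l r t ((n : ℝ) + 1) y) atTop
      (nhds (∫ y in l..r, s (x, y))) := by
  have : ∫ y in l..r, s (x, y) = ∫ y, s (x, y) * (Icc l r).indicator 1 y := by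
    rw [intervalIntegral.integral_of_le (hlt.trans htr), ← integral_Icc_eq_integral_Ioc,
      ← integral_indicator measurableSet_Icc]
    congr 1
    ext y
    by_cases hy : y ∈ Icc l r <;> simp [hy]
  rw [this]
  have hk : ∀ n : ℕ, (1 : ℝ) ≤ (n : ℝ) + 1 := fun n => by
    linarith [(Nat.cast_nonneg n : (0 : ℝ) ≤ n)]
  apply tendsto_integral_of_dominated_convergence
    ((Icc (l - 1) (r + 1)).indicator (fun y => |s (x, y)| * 2))
  · intro n
    exact ((s_meas hs x).mul (tri_cont _ _ _ _).measurable).aestronglyMeasurable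
  · rw [integrable_indicator_iff measurableSet_Icc]
    exact ((s_intOn hs x _ _ (by linarith)).abs).mul_const 2
  · intro n
    filter_upwards with y
    by_cases hy : y ∈ Icc (l - 1) (r + 1)
    · rw [indicator_of_mem hy, norm_mul, Real.norm_eq_abs, Real.norm_eq_abs,
        abs_of_nonneg (tri_nonneg (hk n) y)]
      exact mul_le_mul_of_nonneg_left (tri_le (hk n) y) (abs_nonneg _)
    · rw [indicator_of_notMem hy, tri_zero hlt htr (hk n) y hy]
      simp
  · filter_upwards with y
    exact (tri_tendsto l r t y).const_mul _

lemma s_le {s : ℝ × ℝ → ℝ} (hs : StrictlyF0Consistent s) (x l r t : ℝ) (hlt : l ≤ t)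
    (htr : t ≤ r) : ∫ y in l..r, s (t, y) ≤ ∫ y in l..r, s (x, y) := by
  refine le_of_tendsto_of_tendsto' (s_lim hs t l r t hlt htr) (s_lim hs x l r t hlt htr) ?_
  intro n
  have hk : (1 : ℝ) ≤ (n : ℝ) + 1 := by linarith [(Nat.cast_nonneg n : (0 : ℝ) ≤ n)]
  have hc := tri_int_pos hlt htr hk
  have h := (hs.2.2 _ t (tri_uni hlt htr hk) x).1
  simp only [← mul_div_assoc] at h
  rw [integral_div, integral_div] at h
  exact (div_le_div_iff_of_pos_right hc).1 h

lemma s_eq {s : ℝ × ℝ → ℝ} (hs : StrictlyF0Consistent s) {a b l r : ℝ} (ha : a ∈ Icc l r)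
    (hb : b ∈ Icc l r) : ∫ y in l..r, s (a, y) = ∫ y in l..r, s (b, y) :=
  le_antisymm (s_le hs b l r a ha.1 ha.2) (s_le hs a l r b hb.1 hb.2)

lemma s_prim {s : ℝ × ℝ → ℝ} (hs : StrictlyF0Consistent s) {a b : ℝ} (hab : a < b) (x : ℝ) :
    ∫ y in a..x, s (a, y) = ∫ y in a..x, s (b, y) := by
  have hi : ∀ z p q : ℝ, IntervalIntegrable (fun y => s (z, y)) volume p q := fun z p q =>
    intervalIntegrable_iff.mpr (((s_loc hs z).integrableOn_isCompact isCompact_uIcc).mono_set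
      uIoc_subset_uIcc)
  have hadd : ∀ z p q r : ℝ, (∫ y in p..q, s (z, y)) + (∫ y in q..r, s (z, y))
      = ∫ y in p..r, s (z, y) := fun z p q r =>
    intervalIntegral.integral_add_adjacent_intervals (hi z p q) (hi z q r)
  rcases le_total b x with h | h
  · exact s_eq hs ⟨le_rfl, by linarith⟩ ⟨hab.le, h⟩
  have hab' : ∫ y in a..b, s (a, y) = ∫ y in a..b, s (b, y) :=
    s_eq hs ⟨le_rfl, hab.le⟩ ⟨hab.le, le_rfl⟩
  rcases le_total a x with h' | h'
  · have h1 : ∫ y in a..x, s (a, y) = ∫ y in a..x, s (x, y) :=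
      s_eq hs ⟨le_rfl, h'⟩ ⟨h', le_rfl⟩
    have h2 : ∫ y in a..b, s (x, y) = ∫ y in a..b, s (b, y) :=
      s_eq hs ⟨h', h⟩ ⟨hab.le, le_rfl⟩
    have h3 : ∫ y in x..b, s (x, y) = ∫ y in x..b, s (b, y) :=
      s_eq hs ⟨le_rfl, h⟩ ⟨h, le_rfl⟩
    linarith [hadd x a x b, hadd b a x b]
  · have h1 : ∫ y in x..b, s (a, y) = ∫ y in x..b, s (b, y) :=
      s_eq hs ⟨h', hab.le⟩ ⟨h, le_rfl⟩
    linarith [hadd a a x b, hadd b a x b]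

lemma s_ae {s : ℝ × ℝ → ℝ} (hs : StrictlyF0Consistent s) {a b : ℝ} (hab : a < b) :
    ∀ᵐ y : ℝ, s (a, y) = s (b, y) := by
  filter_upwards [LocallyIntegrable.ae_hasDerivAt_integral (s_loc hs a),
    LocallyIntegrable.ae_hasDerivAt_integral (s_loc hs b)]
    with y h1 h2
  have h1 := h1 a
  have h2 := h2 a
  simp only [s_prim hs hab] at h1
  exact h1.unique h2

/-- If `s` is strictly 𝓕₀-consistent for the mode, then for any `a ≠ b` the
`y`-sections at `a` and `b` agree Lebesgue almost everywhere; consequently the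
expected scores agree for every `f ∈ 𝓕₀`. -/
theorem score_sections_ae_eq (s : ℝ × ℝ → ℝ) (hs : StrictlyF0Consistent s)
    (a b : ℝ) (hab : a ≠ b) :
    (∀ᵐ y : ℝ, s (a, y) = s (b, y)) ∧
    (∀ f : ℝ → ℝ, MemF0 f →
      (∫ y : ℝ, s (a, y) * f y) = (∫ y : ℝ, s (b, y) * f y)) := by
  have h : ∀ᵐ y : ℝ, s (a, y) = s (b, y) := by
    rcases lt_or_gt_of_ne hab with h | h
    · exact s_ae hs h
    · filter_upwards [s_ae hs h] with y hy using hy.symm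
  refine ⟨h, fun f _ => integral_congr_ae ?_⟩
  filter_upwards [h] with y hy
  rw [hy]
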